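/- arXiv:1209.1083 — 3 statements merged into one kernel-verified Lean document; each statement's English description precedes it below -/
import Mathlib

section
/- Let M be a module over K[X] (K a field of characteristic zero), separated and complete in the X-adic topology, and p : M → M a K-linear map with p(X•m) = X•p(m) + m for all m. Then for every m ∈ M there is a unique element r(m) ∈ M such that r(m) − ∑_{i<N} ((−1)^i/i!) X^i • p^i(m) ∈ X^N M for all N (i.e. r(m) is the X-adic sum of the series ∑_{i≥0} ((−1)^i/i!) X^i p^i m). The resulting map r : M → M satisfies: (a) p(r(m)) = 0 for all m ∈ M; (b) r(X•m) = 0 for all m ∈ M; and (c) for every m ∈ M and every N, m − ∑_{i<N} (1/i!) X^i • r(p^i(m)) ∈ X^N M, i.e. the series ∑_{i≥0} (1/i!) X^i r(p^i m) converges X-adically to m. -/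
open Polynomial Finset

namespace WeylModule

section Filtration

variable {R M : Type*} [CommRing R] [AddCommGroup M] [Module R M]

theorem mem_span_singleton_pow_smul_top {a : R} {N : ℕ} {x : M} :
    x ∈ (Ideal.span {a}) ^ N • (⊤ : Submodule R M) ↔ ∃ y : M, a ^ N • y = x := by
  rw [Ideal.span_singleton_pow, Submodule.ideal_span_singleton_smul,
    Submodule.mem_smul_pointwise_iff_exists]
  simp

theorem eq_zero_of_forall_mem_pow_smul_top {I : Ideal R} [IsHausdorff I M] {x : M}
    (h : ∀ N : ℕ, x ∈ I ^ N • (⊤ : Submodule R M)) : x = 0 :=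
  IsHausdorff.haus ‹_› x fun n => by simpa [SModEq.zero] using h n

theorem pow_smul_top_antitone (I : Ideal R) :
    Antitone fun N : ℕ => I ^ N • (⊤ : Submodule R M) :=
  fun _ _ h => Submodule.smul_mono_left (Ideal.pow_le_pow_right h)

/-- A series whose `i`-th term lies in `I ^ i • ⊤` has a unique sum in an `I`-adically complete
module. -/
theorem existsUnique_adic_sum {I : Ideal R} [IsAdicComplete I M] (f : ℕ → M)
    (hf : ∀ i, f i ∈ I ^ i • (⊤ : Submodule R M)) :
    ∃! y : M, ∀ N : ℕ, y - ∑ i ∈ range N, f i ∈ I ^ N • (⊤ : Submodule R M) := by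
  obtain ⟨y, hy⟩ := IsPrecomplete.prec (I := I) (M := M) inferInstance
    (f := fun N => ∑ i ∈ range N, f i) fun {a b} hab => by
      rw [SModEq.comm, SModEq.sub_mem, ← sum_Ico_eq_sub _ hab]
      exact Submodule.sum_mem _ fun i hi =>
        pow_smul_top_antitone I (mem_Ico.mp hi).1 (hf i)
  refine ⟨y, fun N => SModEq.sub_mem.mp (hy N).symm, fun z hz => ?_⟩
  refine sub_eq_zero.mp (eq_zero_of_forall_mem_pow_smul_top (I := I) fun N => ?_)
  simpa using sub_mem (hz N) (SModEq.sub_mem.mp (hy N).symm)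

end Filtration

section Commutation

variable {K M : Type*} [Field K] [AddCommGroup M] [Module K[X] M] [Module K M]
  {p : M →ₗ[K] M}

theorem map_X_pow_succ_smul [IsScalarTower K K[X] M]
    (hp : ∀ m : M, p ((X : K[X]) • m) = (X : K[X]) • p m + m) (n : ℕ) (m : M) :
    p ((X : K[X]) ^ (n + 1) • m)
      = (X : K[X]) ^ (n + 1) • p m + ((n : K) + 1) • ((X : K[X]) ^ n • m) := by
  induction n with
  | zero => simp [hp]
  | succ n ih =>
    rw [pow_succ' X (n + 1), mul_smul, hp, ih, smul_add, smul_comm X ((n : K) + 1),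
      ← mul_smul, ← mul_smul, ← pow_succ' X n, add_assoc]
    push_cast
    module

theorem pow_succ_map_X_smul
    (hp : ∀ m : M, p ((X : K[X]) • m) = (X : K[X]) • p m + m) (n : ℕ) (m : M) :
    (p ^ (n + 1)) ((X : K[X]) • m)
      = (X : K[X]) • (p ^ (n + 1)) m + ((n : K) + 1) • (p ^ n) m := by
  induction n with
  | zero => simp [hp]
  | succ n ih =>
    rw [pow_succ' p (n + 1), Module.End.mul_apply, ih, map_add, hp, map_smul,
      ← Module.End.mul_apply, ← Module.End.mul_apply, ← pow_succ' p n, add_assoc, Nat.cast_succ,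
      add_smul ((n : K) + 1) 1, one_smul, add_comm ((p ^ (n + 1)) m)]

end Commutation

section Series

variable {K M : Type*} [Field K] [CharZero K]

theorem neg_one_pow_succ_div_factorial_mul (n : ℕ) :
    (-1 : K) ^ (n + 1) / ((n + 1).factorial : K) * ((n : K) + 1)
      = -((-1 : K) ^ n / (n.factorial : K)) := by
  have h₁ : ((n : K) + 1) ≠ 0 := by exact_mod_cast n.succ_ne_zero
  have h₂ : (n.factorial : K) ≠ 0 := by exact_mod_cast n.factorial_ne_zero
  rw [Nat.factorial_succ]
  push_cast
  field_simp
  ring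

theorem sum_inv_factorial_mul_neg_one_pow_div_factorial (n : ℕ) :
    ∑ k ∈ range (n + 1),
      (k.factorial : K)⁻¹ * ((-1 : K) ^ (n - k) / ((n - k).factorial : K)) = 0 ^ n := by
  have h₀ (k : ℕ) : (k.factorial : K) ≠ 0 := by exact_mod_cast k.factorial_ne_zero
  have h : ((1 : K) + -1) ^ n = _ := add_pow _ _ n
  calc _ = (n.factorial : K)⁻¹ * ((1 : K) + -1) ^ n := by
        rw [h, mul_sum]
        refine sum_congr rfl fun k hk => ?_
        rw [Nat.cast_choose K (mem_range_succ_iff.mp hk)]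
        field_simp [h₀]
        simp
    _ = 0 ^ n := by
        rcases n with _ | n <;> simp

variable [AddCommGroup M] [Module K[X] M] [Module K M] [IsScalarTower K K[X] M]
  {p : M →ₗ[K] M}

theorem map_sum_range_succ
    (hp : ∀ m : M, p ((X : K[X]) • m) = (X : K[X]) • p m + m) (m : M) (N : ℕ) :
    p (∑ i ∈ range (N + 1),
        ((-1 : K) ^ i / (i.factorial : K)) • ((X : K[X]) ^ i • (p ^ i) m))
      = ((-1 : K) ^ N / (N.factorial : K)) • ((X : K[X]) ^ N • (p ^ (N + 1)) m) := by
  induction N with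
  | zero => simp
  | succ N ih =>
    rw [sum_range_succ, map_add, ih, map_smul, map_X_pow_succ_smul hp, smul_add, smul_smul,
      neg_one_pow_succ_div_factorial_mul, ← Module.End.mul_apply, ← pow_succ' p]
    module

theorem sum_range_succ_X_smul
    (hp : ∀ m : M, p ((X : K[X]) • m) = (X : K[X]) • p m + m) (m : M) (N : ℕ) :
    ∑ i ∈ range (N + 1),
        ((-1 : K) ^ i / (i.factorial : K)) • ((X : K[X]) ^ i • (p ^ i) ((X : K[X]) • m))
      = ((-1 : K) ^ N / (N.factorial : K)) • ((X : K[X]) ^ (N + 1) • (p ^ N) m) := by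
  induction N with
  | zero => simp
  | succ N ih =>
    rw [sum_range_succ, ih, pow_succ_map_X_smul hp, smul_add, smul_add, ← mul_smul, ← pow_succ,
      smul_comm (X ^ (N + 1)) ((N : K) + 1), smul_smul _ ((N : K) + 1),
      neg_one_pow_succ_div_factorial_mul]
    module

/-- The finite form of the identity `∑ q ^ i r p ^ i / i! = 1`. -/
theorem sum_inv_factorial_smul_sum (p : M →ₗ[K] M) (m : M) (N : ℕ) :
    ∑ i ∈ range (N + 1), (i.factorial : K)⁻¹ • ((X : K[X]) ^ i •
      ∑ j ∈ range (N + 1 - i),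
        ((-1 : K) ^ j / (j.factorial : K)) • ((X : K[X]) ^ j • (p ^ j) ((p ^ i) m))) = m := by
  have h := sum_range_diag_flip (N + 1) fun i j =>
    ((i.factorial : K)⁻¹ * ((-1 : K) ^ j / (j.factorial : K))) •
      ((X : K[X]) ^ (i + j) • (p ^ (i + j)) m)
  calc _ = _ := by
        refine sum_congr rfl fun i _ => ?_
        rw [smul_sum, smul_sum]
        refine sum_congr rfl fun j _ => ?_
        rw [smul_comm (X ^ i), smul_smul, smul_smul, ← pow_add, ← Module.End.mul_apply,
          ← pow_add, add_comm j i]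
    _ = _ := h.symm
    _ = ∑ n ∈ range (N + 1), (0 : K) ^ n • ((X : K[X]) ^ n • (p ^ n) m) := by
        refine sum_congr rfl fun n _ => ?_
        rw [← sum_inv_factorial_mul_neg_one_pow_div_factorial, sum_smul]
        refine sum_congr rfl fun k hk => ?_
        rw [Nat.add_sub_cancel' (mem_range_succ_iff.mp hk)]
    _ = m := by simp [sum_range_succ']

end Series

end WeylModule

open WeylModule in
/-- In the setting of a `K[X]`-module `M`, separated and complete in the
`X`-adic topology, with a `K`-linear map `p` satisfying `p(X•m) = X•p(m) + m`:
for every `m` the series `∑ ((-1)^i/i!) X^i • p^i m` has a unique `X`-adic sum `r m`,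
and the resulting map `r` satisfies `p ∘ r = 0`, `r(X•m) = 0`, and
`∑ (1/i!) X^i • r(p^i m)` converges `X`-adically to `m`. -/
theorem weyl_module_projector
    {K : Type*} [Field K] [CharZero K]
    {M : Type*} [AddCommGroup M] [Module (Polynomial K) M]
    [Module K M] [IsScalarTower K (Polynomial K) M]
    [IsAdicComplete (Ideal.span {(Polynomial.X : Polynomial K)}) M]
    (p : M →ₗ[K] M)
    (hp : ∀ m : M, p ((Polynomial.X : Polynomial K) • m)
        = (Polynomial.X : Polynomial K) • p m + m) :
    (∀ m : M, ∃! y : M, ∀ N : ℕ,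
        y - ∑ i ∈ Finset.range N,
            ((-1 : K) ^ i / (Nat.factorial i : K)) •
              ((Polynomial.X : Polynomial K) ^ i • (p ^ i) m) ∈
          (Ideal.span {(Polynomial.X : Polynomial K)}) ^ N • (⊤ : Submodule (Polynomial K) M)) ∧
    (∀ r : M → M,
      (∀ m : M, ∀ N : ℕ,
          r m - ∑ i ∈ Finset.range N,
              ((-1 : K) ^ i / (Nat.factorial i : K)) •
                ((Polynomial.X : Polynomial K) ^ i • (p ^ i) m) ∈
            (Ideal.span {(Polynomial.X : Polynomial K)}) ^ N •
              (⊤ : Submodule (Polynomial K) M)) →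
      ((∀ m : M, p (r m) = 0) ∧
       (∀ m : M, r ((Polynomial.X : Polynomial K) • m) = 0) ∧
       (∀ m : M, ∀ N : ℕ,
          m - ∑ i ∈ Finset.range N,
              ((Nat.factorial i : K)⁻¹) •
                ((Polynomial.X : Polynomial K) ^ i • r ((p ^ i) m)) ∈
            (Ideal.span {(Polynomial.X : Polynomial K)}) ^ N •
              (⊤ : Submodule (Polynomial K) M)))) := by
  have hK {N : ℕ} (c : K) {x : M}
      (hx : x ∈ (Ideal.span {(X : K[X])}) ^ N • (⊤ : Submodule K[X] M)) :
      c • x ∈ (Ideal.span {(X : K[X])}) ^ N • (⊤ : Submodule K[X] M) :=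
    Submodule.smul_of_tower_mem _ c hx
  refine ⟨fun m => existsUnique_adic_sum _ fun i =>
    hK _ (mem_span_singleton_pow_smul_top.mpr ⟨_, rfl⟩), fun r hr => ⟨fun m => ?_, fun m => ?_,
    fun m N => ?_⟩⟩
  · refine eq_zero_of_forall_mem_pow_smul_top (I := Ideal.span {(X : K[X])}) fun N => ?_
    obtain ⟨y, hy⟩ := mem_span_singleton_pow_smul_top.mp (hr m (N + 1))
    rw [← sub_add_cancel (r m), ← hy, map_add, map_sum_range_succ hp, map_X_pow_succ_smul hp]
    refine add_mem (add_mem ?_ (hK _ ?_)) (hK _ ?_) <;> rw [mem_span_singleton_pow_smul_top]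
    exacts [⟨X • p y, by rw [← mul_smul, pow_succ]⟩, ⟨_, rfl⟩, ⟨_, rfl⟩]
  · refine eq_zero_of_forall_mem_pow_smul_top (I := Ideal.span {(X : K[X])}) fun N => ?_
    refine pow_smul_top_antitone _ N.le_succ ?_
    have h := hr ((X : K[X]) • m) (N + 1)
    rw [sum_range_succ_X_smul hp] at h
    exact (Submodule.sub_mem_iff_left _
      (hK _ (mem_span_singleton_pow_smul_top.mpr ⟨_, rfl⟩))).mp h
  · rcases N with _ | N
    · simp
    · nth_rewrite 1 [← sum_inv_factorial_smul_sum p m N]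
      rw [← sum_sub_distrib]
      refine Submodule.sum_mem _ fun i hi => ?_
      obtain ⟨y, hy⟩ := mem_span_singleton_pow_smul_top.mp (hr ((p ^ i) m) (N + 1 - i))
      rw [← smul_sub, ← smul_sub, ← neg_sub, ← hy]
      refine hK _ (mem_span_singleton_pow_smul_top.mpr ⟨-y, ?_⟩)
      rw [← smul_neg, ← mul_smul, ← pow_add, Nat.add_sub_cancel' (mem_range.mp hi).le]
end

section
/- Let n ≥ 1, let 1 ≤ m ≤ n, let λ be a partition of 2n and μ a partition of 2(n−m) (padded with zeros) such that λ_i = μ_i + 2 for 1 ≤ i ≤ m and λ_i = μ_i for i > m. Assume that λ, λ^t and μ are all of type C. Then μ^t is also of type C. -/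
/-- A partition of `n`: a non-increasing finitely supported sequence of natural numbers
(indexed from `0`) summing to `n`. -/
structure PartitionOf (n : ℕ) where
  parts : ℕ → ℕ
  antitone : ∀ i j : ℕ, i ≤ j → parts j ≤ parts i
  finite_support : (Function.support parts).Finite
  sum_eq : ∑ᶠ i, parts i = n

/-- The multiplicity of the value `v` among the parts of the sequence `f`. -/
noncomputable def partMult (f : ℕ → ℕ) (v : ℕ) : ℕ := {i : ℕ | f i = v}.ncard

/-- The transpose (conjugate) sequence: `(f^t)_i = #{j : f_j ≥ i+1}` (0-based indexing,
so this is `#{j : f_j ≥ i}` in 1-based indexing). -/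
noncomputable def transposeFn (f : ℕ → ℕ) : ℕ → ℕ := fun i => {j : ℕ | i + 1 ≤ f j}.ncard

/-- Dominance order: `f ⊴ g`. -/
def Dominated (f g : ℕ → ℕ) : Prop :=
  ∀ k : ℕ, ∑ i ∈ Finset.range k, f i ≤ ∑ i ∈ Finset.range k, g i

/-- A sequence is of type C if every odd part occurs with even multiplicity. -/
def IsTypeC (f : ℕ → ℕ) : Prop := ∀ v : ℕ, 0 < v → Odd v → Even (partMult f v)

/-- For an antitone sequence taking a value at most `i`, the `i`-th entry of the transpose is
greater than `k` exactly when `f k` is greater than `i`. -/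
theorem lt_transposeFn_iff {f : ℕ → ℕ} (hf : Antitone f) {i : ℕ} (hex : ∃ j, f j ≤ i) (k : ℕ) :
    k < transposeFn f i ↔ i < f k := by
  have hset : {j : ℕ | i + 1 ≤ f j} = Set.Iio (Nat.find hex) := by
    ext j
    simp only [Set.mem_ofPred_eq, Set.mem_Iio, Nat.lt_find_iff, not_le]
    exact ⟨fun h l hl => lt_of_lt_of_le h (hf hl), fun h => h j le_rfl⟩
  have hmem : k ∈ {j : ℕ | i + 1 ≤ f j} ↔ k < Nat.find hex := by rw [hset, Set.mem_Iio]
  have hcard : transposeFn f i = Nat.find hex := by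
    rw [transposeFn, hset, ← Finset.coe_Iio, Set.ncard_coe_finset, Nat.card_Iio]
  rw [hcard, ← hmem]
  exact Nat.succ_le_iff

/-- The multiplicity of `k + 1` in the transpose is the difference of consecutive parts. -/
theorem partMult_transposeFn_succ {f : ℕ → ℕ} (hf : Antitone f) (hex : ∃ j, f j = 0) (k : ℕ) :
    partMult (transposeFn f) (k + 1) = f k - f (k + 1) := by
  have hset : {i : ℕ | transposeFn f i = k + 1} = Set.Ico (f (k + 1)) (f k) := by
    ext i
    have hi : ∃ j, f j ≤ i := hex.imp fun _ hj => by simp [hj]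
    have hk := lt_transposeFn_iff hf hi k
    have hk' := lt_transposeFn_iff hf hi (k + 1)
    simp only [Set.mem_ofPred_eq, Set.mem_Ico]
    omega
  rw [partMult, hset, ← Finset.coe_Ico, Set.ncard_coe_finset, Nat.card_Ico]

theorem PartitionOf.exists_parts_eq_zero {n : ℕ} (p : PartitionOf n) : ∃ j, p.parts j = 0 := by
  obtain ⟨j, hj⟩ := p.finite_support.exists_notMem
  exact ⟨j, Function.notMem_support.mp hj⟩

/-- The transpose of a partition is of type C exactly when the parts pair up, from the largest
on, into pairs of equal parity. -/
theorem PartitionOf.isTypeC_transposeFn_iff {n : ℕ} (p : PartitionOf n) :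
    IsTypeC (transposeFn p.parts) ↔
      ∀ k, Even k → (Even (p.parts k) ↔ Even (p.parts (k + 1))) := by
  have key (k : ℕ) : Even (partMult (transposeFn p.parts) (k + 1)) ↔
      (Even (p.parts k) ↔ Even (p.parts (k + 1))) := by
    rw [partMult_transposeFn_succ p.antitone p.exists_parts_eq_zero,
      Nat.even_sub (p.antitone k (k + 1) k.le_succ)]
  constructor
  · intro h k hk
    exact (key k).mp (h (k + 1) k.succ_pos hk.add_one)
  · rintro h (_ | k) hv hodd
    · exact absurd hv (lt_irrefl 0)
    · exact (key k).mpr (h k (by simpa [Nat.odd_add_one] using hodd))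

/-- if a special type-C partition `λ` of `2n` is obtained from a type-C
partition `μ` of `2(n−m)` by adding `2` to each of the first `m` parts (case (a) of
Lusztig–Spaltenstein induction), then `μ^t` is also of type C, i.e. `μ` is special. -/
theorem induced_from_special_typeC
    {n m : ℕ} (hn : 1 ≤ n) (hm1 : 1 ≤ m) (hmn : m ≤ n)
    (lam : PartitionOf (2 * n)) (mu : PartitionOf (2 * (n - m)))
    (hrel1 : ∀ i : ℕ, i < m → lam.parts i = mu.parts i + 2)
    (hrel2 : ∀ i : ℕ, m ≤ i → lam.parts i = mu.parts i)
    (hlamC : IsTypeC lam.parts)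
    (hlamtC : IsTypeC (transposeFn lam.parts))
    (hmuC : IsTypeC mu.parts) :
    IsTypeC (transposeFn mu.parts) := by
  have hparity (i : ℕ) : Even (lam.parts i) ↔ Even (mu.parts i) := by
    rcases lt_or_ge i m with hi | hi
    · rw [hrel1 i hi, Nat.even_add]
      simp
    · rw [hrel2 i hi]
  rw [PartitionOf.isTypeC_transposeFn_iff] at hlamtC ⊢
  simpa only [hparity] using hlamtC
end

section
/- Let λ be a partition of 2n whose set of parts is exactly {1, 2, …, k} for some k ≥ 1, with every part occurring with even (positive) multiplicity. Let ν = r(λ^t) be the partition of 2n+1 obtained from λ^t by increasing its largest part by 1. Then there exists a partition ρ of 2n+1 such that: ρ is of type B; ρ is dominated by ν; every partition of 2n+1 of type B that is dominated by ν is dominated by ρ (so ρ is the B-collapse [ν]_B of ν); and every nonzero part of ρ is odd. -/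
/-- A sequence is of type B if every even part occurs with even multiplicity. -/
def IsTypeB (f : ℕ → ℕ) : Prop := ∀ v : ℕ, 0 < v → Even v → Even (partMult f v)

/-- If an antitone type B sequence drops strictly after an even number of entries, then the sum of
these entries is even. -/
theorem IsTypeB.even_sum_range {f : ℕ → ℕ} (hB : IsTypeB f) (hf : Antitone f) {m : ℕ}
    (hm : Even m) (hdrop : ∀ i < m, f m < f i) : Even (∑ i ∈ Finset.range m, f i) := by
  have key : Even (∑ i ∈ Finset.range m, (f i + 1)) := by
    rw [Finset.sum_comp (fun v => v + 1) f]
    refine Finset.even_sum _ fun v hv => ?_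
    obtain ⟨i, hi, rfl⟩ := Finset.mem_image.mp hv
    have hlt : f m < f i := hdrop i (Finset.mem_range.mp hi)
    rcases Nat.even_or_odd (f i) with he | ho
    · have hset : {j | f j = f i} = ↑({j ∈ Finset.range m | f j = f i} : Finset ℕ) := by
        ext j
        simp only [Set.mem_ofPred_eq, Finset.coe_filter, Finset.mem_range]
        refine ⟨fun h => ⟨?_, h⟩, fun h => h.2⟩
        by_contra! hj
        have := hf hj
        omega
      have h := hB (f i) (by omega) he
      rw [partMult, hset, Set.ncard_coe_finset] at h
      exact h.mul_right _
    · exact (ho.add_odd odd_one).mul_left _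
  rw [Finset.sum_add_distrib] at key
  simpa [Nat.even_add, hm] using key

theorem Dominated.sum_range_ne {f g : ℕ → ℕ} (hfg : Dominated f g) (hB : IsTypeB f)
    (hf : Antitone f) {m : ℕ} (hm : Even m) (hpos : 0 < m) (hdrop : g m < g (m - 1))
    (hodd : Odd (∑ i ∈ Finset.range m, g i)) :
    ∑ i ∈ Finset.range m, f i ≠ ∑ i ∈ Finset.range m, g i := by
  intro heq
  obtain ⟨m, rfl⟩ : ∃ l, m = l + 1 := ⟨m - 1, by omega⟩
  have h₁ := hfg m
  have h₂ := hfg (m + 1 + 1)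
  rw [Finset.sum_range_succ _ (m + 1), Finset.sum_range_succ _ (m + 1)] at h₂
  have h₃ := heq
  rw [Finset.sum_range_succ, Finset.sum_range_succ] at h₃
  simp only [Nat.add_sub_cancel] at hdrop
  refine Nat.not_even_iff_odd.mpr hodd (heq ▸ hB.even_sum_range hf hm fun i hi => ?_)
  have := hf (Nat.le_of_lt_succ hi)
  omega

/-- The sequence obtained from `mu` by increasing by `1` the entries with even index at most `k`
and decreasing by `1` the entries with odd index. -/
def alternatingShift (mu : ℕ → ℕ) (k i : ℕ) : ℕ :=
  if Even i then (if i ≤ k then mu i + 1 else 0) else mu i - 1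

section alternatingShift

variable {mu : ℕ → ℕ} {k : ℕ}

theorem alternatingShift_antitone (hstep : ∀ i < k, mu (i + 1) + 2 ≤ mu i)
    (hzero : ∀ i, k ≤ i → mu i = 0) : Antitone (alternatingShift mu k) := by
  refine antitone_nat_of_succ_le fun i => ?_
  have h₁ := hstep i
  have h₂ := hzero i
  have h₃ := hzero (i + 1)
  unfold alternatingShift
  rcases Nat.even_or_odd i with he | ho
  · have : ¬ Even (i + 1) := by simpa [Nat.even_add_one] using he
    simp only [he, this, if_true, if_false]
    split_ifs <;> omega
  · have h : ¬ Even i := Nat.not_even_iff_odd.mpr ho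
    have : Even (i + 1) := by simpa [Nat.even_add_one] using h
    simp only [h, this, if_true, if_false]
    split_ifs <;> omega

theorem alternatingShift_odd (heven : ∀ i, Even (mu i)) {i : ℕ}
    (hi : alternatingShift mu k i ≠ 0) : Odd (alternatingShift mu k i) := by
  have := heven i
  unfold alternatingShift at hi ⊢
  split_ifs at hi ⊢ with h₁ h₂ <;> grind

theorem alternatingShift_eq_zero (hzero : ∀ i, k ≤ i → mu i = 0) {i : ℕ} (hi : k < i) :
    alternatingShift mu k i = 0 := by
  simp [alternatingShift, hzero i hi.le, hi.not_ge]

theorem sum_range_alternatingShift (hstep : ∀ i < k, mu (i + 1) + 2 ≤ mu i)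
    (hzero : ∀ i, k ≤ i → mu i = 0) (m : ℕ) :
    ∑ i ∈ Finset.range m, alternatingShift mu k i + (if Even m ∧ 0 < m ∧ m ≤ k then 1 else 0) =
      ∑ i ∈ Finset.range m, Function.update mu 0 (mu 0 + 1) i := by
  induction m with
  | zero => simp
  | succ m ih =>
    rw [Finset.sum_range_succ, Finset.sum_range_succ, ← ih]
    have h₁ := hstep m
    have h₂ := hzero m
    simp only [alternatingShift, Function.update_apply]
    rcases Nat.even_or_odd m with he | ho
    · have : ¬ Even (m + 1) := by simpa [Nat.even_add_one] using he
      simp only [he, this, if_true, true_and, false_and, if_false]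
      rcases Nat.eq_zero_or_pos m with rfl | hm
      · simp
      · split_ifs <;> omega
    · have h : ¬ Even m := Nat.not_even_iff_odd.mpr ho
      have : Even (m + 1) := by simpa [Nat.even_add_one] using h
      have : m ≠ 0 := by rintro rfl; simp at h
      simp only [*, true_and, false_and, if_false]
      split_ifs <;> omega

end alternatingShift

theorem sum_range_succ_update_zero (mu : ℕ → ℕ) (m : ℕ) :
    ∑ i ∈ Finset.range (m + 1), Function.update mu 0 (mu 0 + 1) i =
      ∑ i ∈ Finset.range (m + 1), mu i + 1 := by
  rw [Finset.sum_range_succ', Finset.sum_range_succ']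
  simp [add_assoc]

theorem finite_setOf_lt_of_finite_support {f : ℕ → ℕ} (hf : (Function.support f).Finite) (i : ℕ) :
    {j | i + 1 ≤ f j}.Finite :=
  hf.subset fun j hj => by
    simp only [Set.mem_ofPred_eq] at hj
    simp only [Function.mem_support]
    omega

theorem transposeFn_eq_add_partMult {f : ℕ → ℕ} (hf : (Function.support f).Finite) (i : ℕ) :
    transposeFn f i = transposeFn f (i + 1) + partMult f (i + 1) := by
  have hfin := finite_setOf_lt_of_finite_support hf
  unfold transposeFn partMult
  rw [← Set.ncard_union_eq _ (hfin (i + 1)) ((hfin i).subset fun j hj => hj.ge)]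
  · congr 1
    ext j
    simp only [Set.mem_ofPred_eq, Set.mem_union]
    omega
  · refine Set.disjoint_left.mpr fun j h₁ h₂ => ?_
    simp only [Set.mem_ofPred_eq] at h₁ h₂
    omega

theorem transposeFn_eq_zero {f : ℕ → ℕ} {k : ℕ} (hbound : ∀ j, f j ≤ k) {i : ℕ} (hi : k ≤ i) :
    transposeFn f i = 0 := by
  have : {j | i + 1 ≤ f j} = ∅ := by
    ext j
    have := hbound j
    simp only [Set.mem_ofPred_eq, Set.mem_empty_iff_false, iff_false]
    omega
  rw [transposeFn, this, Set.ncard_empty]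

theorem sum_range_transposeFn {f : ℕ → ℕ} (hf : (Function.support f).Finite) {m : ℕ}
    (hbound : ∀ j, f j ≤ m) : ∑ i ∈ Finset.range m, transposeFn f i = ∑ᶠ j, f j := by
  rw [finsum_eq_sum _ hf]
  have hcard : ∀ i, transposeFn f i = ∑ j ∈ hf.toFinset, if i + 1 ≤ f j then 1 else 0 := by
    intro i
    rw [← Finset.card_filter, transposeFn, ← Set.ncard_coe_finset]
    congr 1
    ext j
    simp only [Set.mem_ofPred_eq, Finset.coe_filter, Set.Finite.mem_toFinset, Function.mem_support]
    omega
  simp only [hcard]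
  rw [Finset.sum_comm]
  refine Finset.sum_congr rfl fun j _ => ?_
  rw [← Finset.card_filter]
  have : {i ∈ Finset.range m | i + 1 ≤ f j} = Finset.range (f j) := by
    ext i
    have := hbound j
    simp only [Finset.mem_filter, Finset.mem_range]
    omega
  rw [this, Finset.card_range]

/-- let `λ` be a partition of `2n` whose parts are exactly `{1,…,k}`
(`k ≥ 1`), every part with even (positive) multiplicity (the shape of a weakly rigid
special orbit in `sp_{2n}`). Let `ν = r(λ^t)` be obtained from `λ^t` by increasing its
largest part (the entry at index `0`) by `1`. Then the B-collapse `[ν]_B` exists as a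
partition `ρ` of `2n+1` — type B, dominated by `ν`, and dominance-largest among type-B
partitions of `2n+1` dominated by `ν` — and all nonzero parts of `ρ` are odd. -/
theorem collapse_B_of_dual_weakly_rigid_typeC_is_odd
    {n k : ℕ} (hk : 1 ≤ k) (lam : PartitionOf (2 * n))
    (hbound : ∀ i : ℕ, lam.parts i ≤ k)
    (hall : ∀ v : ℕ, 1 ≤ v → v ≤ k → ∃ i : ℕ, lam.parts i = v)
    (heven : ∀ v : ℕ, 1 ≤ v → v ≤ k → Even (partMult lam.parts v))
    (nu : ℕ → ℕ)
    (hnu : nu = Function.update (transposeFn lam.parts) 0 (transposeFn lam.parts 0 + 1)) :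
    ∃ rho : PartitionOf (2 * n + 1),
      IsTypeB rho.parts ∧
      Dominated rho.parts nu ∧
      (∀ sigma : PartitionOf (2 * n + 1),
        IsTypeB sigma.parts → Dominated sigma.parts nu → Dominated sigma.parts rho.parts) ∧
      (∀ i : ℕ, rho.parts i ≠ 0 → Odd (rho.parts i)) := by
  have hfin := lam.finite_support
  set mu := transposeFn lam.parts
  have hzero : ∀ i, k ≤ i → mu i = 0 := fun i hi => transposeFn_eq_zero hbound hi
  have hrec : ∀ i, mu i = mu (i + 1) + partMult lam.parts (i + 1) :=
    transposeFn_eq_add_partMult hfin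
  have hstep : ∀ i < k, mu (i + 1) + 2 ≤ mu i := by
    intro i hi
    have hpos : 0 < partMult lam.parts (i + 1) := by
      refine (Set.ncard_pos ?_).mpr (hall (i + 1) (by omega) hi)
      exact (finite_setOf_lt_of_finite_support hfin i).subset fun j hj => hj.ge
    have := hrec i
    obtain ⟨c, hc⟩ := heven (i + 1) (by omega) hi
    omega
  have hmu_even : ∀ i, Even (mu i) := by
    intro i
    rcases le_total k i with hi | hi
    · simp [hzero i hi]
    · induction hi using Nat.decreasingInduction with
      | self => simp [hzero k le_rfl]
      | of_succ i hi ih => exact hrec i ▸ ih.add (heven (i + 1) (by omega) hi)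
  have hsum := sum_range_alternatingShift hstep hzero
  rw [← hnu] at hsum
  have hanti := alternatingShift_antitone hstep hzero
  have hodd : ∀ i, alternatingShift mu k i ≠ 0 → Odd (alternatingShift mu k i) :=
    fun i => alternatingShift_odd hmu_even
  have hsupp : Function.support (alternatingShift mu k) ⊆ ↑(Finset.range (k + 1)) := by
    intro i hi
    by_contra h
    exact hi (alternatingShift_eq_zero hzero (by simpa using h))
  refine ⟨⟨alternatingShift mu k, fun i j hij => hanti hij,
    (Finset.finite_toSet _).subset hsupp, ?_⟩, ?_, ?_, ?_, hodd⟩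
  · have h := hsum (k + 1)
    rw [if_neg (by omega), hnu, sum_range_succ_update_zero,
      sum_range_transposeFn hfin fun j => (hbound j).trans k.le_succ, lam.sum_eq] at h
    rw [finsum_eq_sum_of_support_subset _ hsupp]
    exact h
  · intro v hv hve
    have : {i | alternatingShift mu k i = v} = ∅ := by
      refine Set.eq_empty_iff_forall_notMem.mpr fun i hi => ?_
      rw [Set.mem_ofPred_eq] at hi
      exact Nat.not_even_iff_odd.mpr (hi ▸ hodd i (by omega)) hve
    simp [partMult, this]
  · exact fun m => (hsum m).le.trans' (Nat.le_add_right _ _)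
  · intro sigma hB hdom m
    change _ ≤ ∑ i ∈ Finset.range m, alternatingShift mu k i
    have hle := hdom m
    have hm := hsum m
    split_ifs at hm with hcase
    · obtain ⟨hme, hmpos, hmk⟩ := hcase
      have hne := hdom.sum_range_ne hB (fun i j => sigma.antitone i j) hme hmpos ?_ ?_
      · omega
      · have := hstep (m - 1) (by omega)
        rw [Nat.sub_add_cancel hmpos] at this
        rw [hnu, Function.update_of_ne hmpos.ne', Function.update_apply]
        split_ifs with h
        · rw [h] at this
          omega
        · omega
      · obtain ⟨l, rfl⟩ : ∃ l, m = l + 1 := ⟨m - 1, by omega⟩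
        rw [hnu, sum_range_succ_update_zero]
        exact (Finset.even_sum _ fun i _ => hmu_even i).add_one
    · omega
end
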